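/- arXiv:2605.09700 — 3 statements merged into one kernel-verified Lean document; each statement's English description precedes it below -/
import Mathlib

section
/- (Céa's lemma) Let V_h be a closed subspace of H, let u ∈ H satisfy a(u, v) = f(v) for all v ∈ H, and let u_h ∈ V_h satisfy a(u_h, v_h) = f(v_h) for all v_h ∈ V_h. Then ‖u − u_h‖ ≤ (M/μ)·‖u − w‖ for every w ∈ V_h; in particular ‖u − u_h‖ ≤ (M/μ)·inf_{w ∈ V_h} ‖u − w‖. -/
/-- Céa's lemma: `‖u − u_h‖ ≤ (M/μ)·‖u − w‖` for every `w ∈ V_h`, hence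
`‖u − u_h‖ ≤ (M/μ)·inf_{w ∈ V_h} ‖u − w‖`.  Symmetry of `a` is not assumed. -/
theorem stmt_4 {H : Type*} [NormedAddCommGroup H] [InnerProductSpace ℝ H] [CompleteSpace H]
    (a : H →ₗ[ℝ] H →ₗ[ℝ] ℝ)
    (M : ℝ) (hM : 0 ≤ M) (hbound : ∀ u v : H, |a u v| ≤ M * ‖u‖ * ‖v‖)
    (μ : ℝ) (hμ : 0 < μ) (hcoer : ∀ v : H, μ * ‖v‖ ^ 2 ≤ a v v)
    (f : H →L[ℝ] ℝ)
    (Vh : Submodule ℝ H) (hVh : IsClosed (Vh : Set H))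
    (u : H) (hu : ∀ v : H, a u v = f v)
    (uh : H) (huh_mem : uh ∈ Vh) (huh : ∀ vh ∈ Vh, a uh vh = f vh) :
    (∀ w ∈ Vh, ‖u - uh‖ ≤ (M / μ) * ‖u - w‖) ∧
      ‖u - uh‖ ≤ (M / μ) * ⨅ w : Vh, ‖u - (w : H)‖ := by
  have key : ∀ w ∈ Vh, ‖u - uh‖ ≤ (M / μ) * ‖u - w‖ := by
    intro w hw
    have galerkin : a (u - uh) (w - uh) = 0 := by
      rw [LinearMap.map_sub₂, hu, huh _ (Vh.sub_mem hw huh_mem), sub_self]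
    have hsplit : a (u - uh) (u - uh) = a (u - uh) (u - w) := by
      rw [← sub_add_sub_cancel u w uh, map_add, sub_add_sub_cancel, galerkin, add_zero]
    have hle : μ * ‖u - uh‖ ^ 2 ≤ M * ‖u - uh‖ * ‖u - w‖ :=
      (hcoer _).trans (hsplit.le.trans ((le_abs_self _).trans (hbound _ _)))
    rw [div_mul_eq_mul_div, le_div_iff₀ hμ]
    rcases (norm_nonneg (u - uh)).eq_or_lt with h | h
    · rw [← h, zero_mul]
      positivity
    · refine le_of_mul_le_mul_left ?_ h
      linarith
  refine ⟨key, ?_⟩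
  rw [Real.mul_iInf_of_nonneg (by positivity)]
  exact le_ciInf fun w => key w w.2
end

section
/- (Gradient simplification of the Ritz loss with respect to network parameters) Let Θ be a real normed vector space, and let A : Θ → Matrix (Fin N) (Fin N) ℝ and F : Θ → ℝᴺ be differentiable at θ₀. Assume A(θ) is symmetric and invertible for every θ, and define c(θ) = A(θ)⁻¹·F(θ) and the loss L(θ) = (1/2)·c(θ)ᵀA(θ)c(θ) − c(θ)ᵀF(θ). Then L is differentiable at θ₀ and its derivative in any direction v is given by L'(θ₀)[v] = (1/2)·c(θ₀)ᵀ·(A'(θ₀)[v])·c(θ₀) − c(θ₀)ᵀ·(F'(θ₀)[v]); that is, the term involving the derivative of c vanishes because A(θ₀)c(θ₀) − F(θ₀) = 0. -/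
open Matrix

attribute [local instance] Matrix.frobeniusNormedAddCommGroup Matrix.frobeniusNormedSpace

/-- The Leibniz rule for a bilinear map out of finite-dimensional spaces. -/
theorem HasFDerivAt.linearMap_bilinear {Θ E G H : Type*} [NormedAddCommGroup Θ] [NormedSpace ℝ Θ]
    [NormedAddCommGroup E] [NormedSpace ℝ E] [FiniteDimensional ℝ E]
    [NormedAddCommGroup G] [NormedSpace ℝ G] [FiniteDimensional ℝ G]
    [NormedAddCommGroup H] [NormedSpace ℝ H] (B : E →ₗ[ℝ] G →ₗ[ℝ] H)
    {f : Θ → E} {g : Θ → G} {f' : Θ →L[ℝ] E} {g' : Θ →L[ℝ] G} {x : Θ}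
    (hf : HasFDerivAt f f' x) (hg : HasFDerivAt g g' x) :
    ∃ D : Θ →L[ℝ] H, HasFDerivAt (fun y => B (f y) (g y)) D x ∧
      ∀ v, D v = B (f x) (g' v) + B (f' v) (g x) :=
  ⟨_, B.toContinuousBilinearMap.hasFDerivAt_of_bilinear hf hg, fun _ => rfl⟩

section

attribute [local instance] Matrix.frobeniusNormedRing Matrix.frobeniusNormedAlgebra

theorem DifferentiableAt.matrix_inv {Θ n : Type*} [NormedAddCommGroup Θ] [NormedSpace ℝ Θ]
    [Fintype n] [DecidableEq n] {A : Θ → Matrix n n ℝ} {x : Θ}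
    (hA : DifferentiableAt ℝ A x) (hx : IsUnit (A x)) :
    DifferentiableAt ℝ (fun y => (A y)⁻¹) x := by
  have : CompleteSpace (Matrix n n ℝ) := FiniteDimensional.complete ℝ _
  simp only [Matrix.nonsing_inv_eq_ringInverse]
  exact hA.inverse hx

end

/-- Gradient simplification of the Ritz loss with respect to the network parameters: with
`c(θ) = A(θ)⁻¹F(θ)` and `L(θ) = (1/2)·c(θ)ᵀA(θ)c(θ) − c(θ)ᵀF(θ)`, the loss is
differentiable at `θ₀` and `L'(θ₀)[v] = (1/2)·c(θ₀)ᵀ(A'(θ₀)[v])c(θ₀) − c(θ₀)ᵀ(F'(θ₀)[v])`;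
the term involving `∂c/∂θ` vanishes since `A(θ₀)c(θ₀) − F(θ₀) = 0`. -/
theorem stmt_7 {Θ : Type*} [NormedAddCommGroup Θ] [NormedSpace ℝ Θ] {N : ℕ}
    (A : Θ → Matrix (Fin N) (Fin N) ℝ) (F : Θ → (Fin N → ℝ))
    (hAsymm : ∀ θ : Θ, (A θ).IsSymm) (hAinv : ∀ θ : Θ, IsUnit (A θ))
    (c : Θ → (Fin N → ℝ)) (hc : ∀ θ : Θ, c θ = (A θ)⁻¹.mulVec (F θ))
    (L : Θ → ℝ)
    (hL : ∀ θ : Θ, L θ = (1 / 2) * (c θ ⬝ᵥ (A θ).mulVec (c θ)) - c θ ⬝ᵥ F θ)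
    (θ₀ : Θ) (A' : Θ →L[ℝ] Matrix (Fin N) (Fin N) ℝ) (F' : Θ →L[ℝ] (Fin N → ℝ))
    (hA' : HasFDerivAt A A' θ₀) (hF' : HasFDerivAt F F' θ₀) :
    ∃ L' : Θ →L[ℝ] ℝ, HasFDerivAt L L' θ₀ ∧
      ∀ v : Θ, L' v = (1 / 2) * (c θ₀ ⬝ᵥ (A' v).mulVec (c θ₀)) - c θ₀ ⬝ᵥ F' v := by
  have hdet : ∀ θ, IsUnit (A θ).det := fun θ => (isUnit_iff_isUnit_det _).1 (hAinv θ)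
  have hsys : ∀ θ, A θ *ᵥ c θ = F θ := fun θ => by
    rw [hc, mulVec_mulVec, mul_nonsing_inv _ (hdet θ), one_mulVec]
  obtain ⟨c', hc', -⟩ := HasFDerivAt.linearMap_bilinear (mulVecBilin ℝ ℝ)
    (hA'.differentiableAt.matrix_inv (hAinv θ₀)).hasFDerivAt hF'
  replace hc' : HasFDerivAt c c' θ₀ := hc'.congr_of_eventuallyEq (.of_forall hc)
  obtain ⟨D, hD, hDv⟩ := HasFDerivAt.linearMap_bilinear (mulVecBilin ℝ ℝ) hA' hc'
  obtain ⟨E, hE, hEv⟩ := HasFDerivAt.linearMap_bilinear (dotProductBilin ℝ ℝ) hc' hF'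
  have hDF : D = F' := hD.unique (hF'.congr_of_eventuallyEq (.of_forall hsys))
  refine ⟨(-(1 / 2 : ℝ)) • E, ?_, fun v => ?_⟩
  · refine (hE.const_smul (-(1 / 2 : ℝ))).congr_of_eventuallyEq (.of_forall fun θ => ?_)
    change L θ = -(1 / 2) * (c θ ⬝ᵥ F θ)
    rw [hL, hsys]
    ring
  · have hF'v : F' v = A θ₀ *ᵥ c' v + A' v *ᵥ c θ₀ := by
      rw [← hDF, hDv]; rfl
    have hsymm : c θ₀ ⬝ᵥ A θ₀ *ᵥ c' v = c' v ⬝ᵥ F θ₀ := by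
      rw [dotProduct_mulVec, ← mulVec_transpose, (hAsymm θ₀).eq, hsys, dotProduct_comm]
    have hv : E v = c θ₀ ⬝ᵥ F' v + c' v ⬝ᵥ F θ₀ := hEv v
    rw [_root_.smul_apply, hv, hF'v, dotProduct_add, hsymm, smul_eq_mul]
    ring
end

section
/- (Weighted norm equivalency for compact families) Let (X, μ) be a measure space and b : X → ℝ a measurable function with 0 ≤ b ≤ C_b μ-almost everywhere for some constant C_b, and b > 0 μ-almost everywhere. Let F be a compact subset of L²(μ) such that ‖v‖_{L²(μ)} = 1 for every v ∈ F. Then there exists a constant C > 0 such that ‖v‖²_{L²(μ)} ≤ C·∫ v²·b dμ for every v ∈ F. -/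
open MeasureTheory
open scoped ENNReal

lemma continuous_integral_sq_mul {X : Type*} [MeasurableSpace X] {μ : Measure X}
    {b : X → ℝ} (hb : MemLp b ∞ μ) :
    Continuous fun v : Lp ℝ 2 μ => ∫ x, (v : X → ℝ) x ^ 2 * b x ∂μ := by
  let T : Lp ℝ 2 μ →L[ℝ] Lp ℝ 2 μ :=
    (ContinuousLinearMap.mul ℝ ℝ).holderL μ ∞ 2 2 (hb.toLp b)
  have hcont : Continuous fun v : Lp ℝ 2 μ => inner ℝ v (T v) :=
    continuous_id.inner T.continuous
  convert hcont using 2 with v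
  rw [L2.inner_def]
  refine integral_congr_ae ?_
  filter_upwards [hb.coeFn_toLp,
    (ContinuousLinearMap.mul ℝ ℝ).coeFn_holder (r := 2) (f := hb.toLp b) (g := v)] with x h1 h2
  have h3 : (T v : X → ℝ) x = b x * v x := by
    rw [← h1]
    exact h2
  rw [h3]
  simp
  ring

lemma integrable_sq_mul {X : Type*} [MeasurableSpace X] {μ : Measure X}
    {b : X → ℝ} (hb : MemLp b ∞ μ) (v : Lp ℝ 2 μ) :
    Integrable (fun x => (v : X → ℝ) x ^ 2 * b x) μ :=
  (Lp.memLp v).integrable_sq.mul_of_top_left hb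

lemma integral_sq_mul_pos {X : Type*} [MeasurableSpace X] {μ : Measure X}
    {b : X → ℝ} (hb : MemLp b ∞ μ) (hb_pos : ∀ᵐ x ∂μ, 0 < b x) {v : Lp ℝ 2 μ} (hv : v ≠ 0) :
    0 < ∫ x, (v : X → ℝ) x ^ 2 * b x ∂μ := by
  have hnonneg : 0 ≤ᵐ[μ] fun x => (v : X → ℝ) x ^ 2 * b x := by
    filter_upwards [hb_pos] with x hx
    exact mul_nonneg (sq_nonneg _) hx.le
  refine (integral_nonneg_of_ae hnonneg).lt_of_ne' fun h => hv ?_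
  rw [integral_eq_zero_iff_of_nonneg_ae hnonneg (integrable_sq_mul hb v)] at h
  rw [Lp.eq_zero_iff_ae_eq_zero]
  filter_upwards [h, hb_pos] with x hx hbx
  simpa [hbx.ne'] using hx

/-- Weighted norm equivalency for compact families: if `b` is a bounded nonnegative
weight, positive a.e., and `F` is a compact family of unit vectors in `L²(μ)`, then there
is `C > 0` with `‖v‖² ≤ C·∫ v²·b dμ` for all `v ∈ F`. -/
theorem stmt_13 {X : Type*} [MeasurableSpace X] (μ : Measure X)
    (b : X → ℝ) (hb_meas : Measurable b)
    (Cb : ℝ) (hb_bound : ∀ᵐ x ∂μ, 0 ≤ b x ∧ b x ≤ Cb)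
    (hb_pos : ∀ᵐ x ∂μ, 0 < b x)
    (F : Set (Lp ℝ 2 μ)) (hF : IsCompact F) (hFnorm : ∀ v ∈ F, ‖v‖ = 1) :
    ∃ C > 0, ∀ v ∈ F, ‖v‖ ^ 2 ≤ C * ∫ x, (v : X → ℝ) x ^ 2 * b x ∂μ := by
  have hb : MemLp b ∞ μ := by
    refine memLp_top_of_bound hb_meas.aestronglyMeasurable Cb ?_
    filter_upwards [hb_bound] with x hx
    rw [Real.norm_of_nonneg hx.1]
    exact hx.2
  rcases F.eq_empty_or_nonempty with rfl | hne
  · exact ⟨1, one_pos, by simp⟩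
  obtain ⟨w, hw, hmin⟩ := hF.exists_isMinOn hne (continuous_integral_sq_mul hb).continuousOn
  have hpos := integral_sq_mul_pos hb hb_pos (v := w) (norm_ne_zero_iff.mp (by simp [hFnorm w hw]))
  refine ⟨_, inv_pos.mpr hpos, fun v hv => ?_⟩
  rw [hFnorm v hv, one_pow, inv_mul_eq_div, one_le_div hpos]
  exact hmin hv
end
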